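/- Fix positive integers d, m with m ≥ d and a nonempty subset T of {a ∈ ℤ_{>0}^d : |a| = m}, where |a| = a_1 + ... + a_d. For l with d ≤ l ≤ m, let h_l(T) = |{x ∈ I(T) : |x| = l}| where I(T) is the down-set of T in ℤ_{>0}^d. Then the sequence (h_d(T), h_{d+1}(T), ..., h_m(T)) is an O-sequence with first entry 1 and second entry at most d. -/

import Mathlib

/-- `IsMacaulayRep f i j m` says that `f = C(m i, i) + C(m (i-1), i-1) + ... + C(m (i-j), i-j)`
is the `i`-binomial (Macaulay) representation of `f`, with
`m i > m (i-1) > ... > m (i-j) ≥ i - j ≥ 1`. -/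
def IsMacaulayRep (f i j : ℕ) (m : ℕ → ℕ) : Prop :=
  j < i ∧ i - j ≤ m (i - j) ∧
  (∀ k, i - j ≤ k → k < i → m k < m (k + 1)) ∧
  f = ∑ k ∈ Finset.Icc (i - j) i, Nat.choose (m k) k

/-- Given the `i`-binomial representation data `(j, m)`, this is `f^⟨i⟩`. -/
def macaulayUpper (i j : ℕ) (m : ℕ → ℕ) : ℕ :=
  ∑ k ∈ Finset.Icc (i - j) i, Nat.choose (m k + 1) (k + 1)

/-- Given the `i`-binomial representation data `(j, m)`, this is `f^(i)`. -/
def macaulayLower (i j : ℕ) (m : ℕ → ℕ) : ℕ :=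
  ∑ k ∈ Finset.Icc (i - j) i, Nat.choose (m k) (k + 1)

/-- `MacaulayLE g f i` expresses `g ≤ f^⟨i⟩` (with the convention `0^⟨i⟩ = 0`). -/
def MacaulayLE (g f i : ℕ) : Prop :=
  (f = 0 ∧ g = 0) ∨ ∃ j m, IsMacaulayRep f i j m ∧ g ≤ macaulayUpper i j m

/-- `(h 0, h 1, ..., h s)` is an O-sequence: `h 0 = 1` and `h (i+1) ≤ (h i)^⟨i⟩`
for each `1 ≤ i ≤ s - 1`. -/
def IsOSequence (s : ℕ) (h : ℕ → ℕ) : Prop :=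
  h 0 = 1 ∧ ∀ i, 1 ≤ i → i < s → MacaulayLE (h (i + 1)) (h i) i

/-- The down-set `I(T) = {b ∈ ℤ_{>0}^d : b ≤ a componentwise for some a ∈ T}`,
with `ℤ_{>0}^d` modeled as functions `Fin d → ℕ` with all values positive. -/
def posDown (d : ℕ) (T : Set (Fin d → ℕ)) : Set (Fin d → ℕ) :=
  {b | (∀ i, 0 < b i) ∧ ∃ a ∈ T, ∀ i, b i ≤ a i}

/-- `MRep i b f q`: `f = ∑ C(a_k, k)`, `q = ∑ C(a_k, k+1)`, `b > a_i > a_{i-1} > ...`. -/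
inductive MRep : ℕ → ℕ → ℕ → ℕ → Prop
  | nil (i b : ℕ) : MRep i b 0 0
  | cons (i b a f q : ℕ) (h : a < b) (hr : MRep i a f q) :
      MRep (i + 1) b (Nat.choose a (i + 1) + f) (Nat.choose a (i + 2) + q)

theorem MRep.weaken {i b b' f q : ℕ} (h : MRep i b f q) (hb : b ≤ b') : MRep i b' f q := by
  cases h with
  | nil => exact MRep.nil _ _
  | cons i _ a f q h hr => exact MRep.cons _ _ _ _ _ (lt_of_lt_of_le h hb) hr

theorem MRep.zero_of_le {i b f q : ℕ} (h : MRep i b f q) (hb : b ≤ i) : f = 0 ∧ q = 0 := by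
  induction h with
  | nil => exact ⟨rfl, rfl⟩
  | cons i b a f q h hr ih =>
    obtain ⟨h1, h2⟩ := ih (by omega)
    subst h1 h2
    rw [Nat.choose_eq_zero_of_lt (by omega), Nat.choose_eq_zero_of_lt (by omega)]
    simp

theorem MRep.f_lt {i b f q : ℕ} (h : MRep i b f q) : ∀ c, b ≤ c → i ≤ c → f < Nat.choose c i := by
  induction h with
  | nil i b => intro c _ hc; exact Nat.choose_pos hc
  | cons i b a f q h hr ih =>
    intro c hc hi
    obtain ⟨c', rfl⟩ : ∃ c', c = c' + 1 := ⟨c - 1, by omega⟩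
    have h1 := ih c' (by omega) (by omega)
    have h2 : Nat.choose a (i + 1) ≤ Nat.choose c' (i + 1) := Nat.choose_le_choose _ (by omega)
    rw [Nat.choose_succ_succ']
    omega

theorem MRep.q_le {i b f q : ℕ} (h : MRep i b f q) : ∀ c, b ≤ c → q ≤ Nat.choose c (i + 1) := by
  induction h with
  | nil i b => intro c _; exact Nat.zero_le _
  | cons i b a f q h hr ih =>
    intro c hc
    obtain ⟨c', rfl⟩ : ∃ c', c = c' + 1 := ⟨c - 1, by omega⟩
    have h1 := ih c' (by omega)
    have h2 : Nat.choose a (i + 2) ≤ Nat.choose c' (i + 2) := Nat.choose_le_choose _ (by omega)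
    rw [Nat.choose_succ_succ]
    have : Nat.choose c' (i + 1).succ = Nat.choose c' (i + 2) := rfl
    omega

theorem MRep.mono {i b f q : ℕ} (h : MRep i b f q) :
    ∀ {b' f' q' : ℕ}, MRep i b' f' q' → f ≤ f' → q ≤ q' := by
  induction h with
  | nil => intros; exact Nat.zero_le _
  | cons i b a f q h hr ih =>
    intro b' f' q' h' hle
    by_cases ha : a < i + 1
    · obtain ⟨h1, h2⟩ := (MRep.cons i (a + 1) a f q (by omega) hr).zero_of_le (by omega)
      omega
    · have hpos : 0 < Nat.choose a (i + 1) := Nat.choose_pos (by omega)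
      cases h' with
      | nil => omega
      | cons _ _ a' f' q' hh' hr' =>
        rcases lt_trichotomy a a' with hlt | heq | hgt
        · have := (MRep.cons i (a + 1) a f q (by omega) hr).q_le a' (by omega)
          have h3 : Nat.choose a' (i + 1 + 1) = Nat.choose a' (i + 2) := rfl
          omega
        · subst heq
          have := ih hr' (by omega)
          omega
        · have := (MRep.cons i (a' + 1) a' f' q' (by omega) hr').f_lt a (by omega) (by omega)
          omega

theorem MRep.exists_of_lt (i : ℕ) : ∀ b f, f < Nat.choose b i → ∃ q, MRep i b f q := by
  induction i with
  | zero =>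
    intro b f h
    rw [Nat.choose_zero_right] at h
    obtain rfl : f = 0 := by omega
    exact ⟨0, MRep.nil _ _⟩
  | succ i ih =>
    intro b
    induction b with
    | zero => intro f h; simp at h
    | succ b ihb =>
      intro f h
      by_cases hf : f < Nat.choose b (i + 1)
      · obtain ⟨q, hq⟩ := ihb f hf
        exact ⟨q, hq.weaken (by omega)⟩
      · rw [Nat.choose_succ_succ] at h
        have h' : Nat.choose b i.succ = Nat.choose b (i + 1) := rfl
        obtain ⟨q, hq⟩ := ih b (f - Nat.choose b (i + 1)) (by omega)
        refine ⟨Nat.choose b (i + 2) + q, ?_⟩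
        · have := MRep.cons i (b + 1) b _ _ (by omega) hq
          rwa [Nat.add_sub_cancel' (by omega)] at this

theorem MRep.exists_succ (i f : ℕ) : ∃ b q, MRep (i + 1) b f q := by
  refine ⟨f + (i + 1), MRep.exists_of_lt (i + 1) (f + (i + 1)) f ?_⟩
  induction f with
  | zero => simp
  | succ f ih =>
    have : f + 1 + (i + 1) = (f + (i + 1)) + 1 := by ring
    rw [this, Nat.choose_succ_succ]
    have h' : Nat.choose (f + (i + 1)) i.succ = Nat.choose (f + (i + 1)) (i + 1) := rfl
    have : 0 < Nat.choose (f + (i + 1)) i := Nat.choose_pos (by omega)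
    omega

theorem MRep.exists_le {i b f q f' : ℕ} (h : MRep i b f q) (hf : f' ≤ f) :
    ∃ b' q', MRep i b' f' q' := by
  cases i with
  | zero =>
    cases h
    obtain rfl : f' = 0 := by omega
    exact ⟨0, 0, MRep.nil _ _⟩
  | succ i => exact MRep.exists_succ i f'

theorem MRep.green : ∀ (i b f q : ℕ), MRep (i + 1) b f q →
    ∃ fm qm e p, MRep (i + 1) (b - 1) fm qm ∧ fm + qm = q ∧ MRep i (b - 1) e p ∧
      ((f = fm + e ∧ f = e + p) ∨ (f = fm + e + 1 ∧ e + p < f)) := by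
  intro i
  induction i with
  | zero =>
    intro b f q h
    cases h with
    | nil => exact ⟨0, 0, 0, 0, MRep.nil _ _, rfl, MRep.nil _ _, Or.inl ⟨rfl, rfl⟩⟩
    | cons _ _ a f q h hr =>
      cases hr
      cases a with
      | zero => exact ⟨0, 0, 0, 0, MRep.nil _ _, rfl, MRep.nil _ _, Or.inl ⟨rfl, rfl⟩⟩
      | succ a =>
        refine ⟨_, _, 0, 0, MRep.cons 0 (b - 1) a 0 0 (by omega) (MRep.nil _ _), ?_,
          MRep.nil _ _, Or.inr ⟨?_, ?_⟩⟩
        · have := Nat.choose_succ_succ a 1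
          simp at this ⊢
          omega
        · simp
        · simp
  | succ i ih =>
    intro b f q h
    cases h with
    | nil => exact ⟨0, 0, 0, 0, MRep.nil _ _, rfl, MRep.nil _ _, Or.inl ⟨rfl, rfl⟩⟩
    | cons _ _ a f q h hr =>
      cases a with
      | zero =>
        obtain ⟨h1, h2⟩ := hr.zero_of_le (by omega)
        subst h1 h2
        exact ⟨0, 0, 0, 0, MRep.nil _ _, by simp, MRep.nil _ _, Or.inl ⟨by simp, by simp⟩⟩
      | succ a =>
        obtain ⟨fm, qm, e, p, h1, h2, h3, h4⟩ := ih _ _ _ hr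
        refine ⟨_, _, _, _, MRep.cons (i + 1) (b - 1) a fm qm (by omega) h1, ?_,
          MRep.cons i (b - 1) a e p (by omega) h3, ?_⟩
        · have := Nat.choose_succ_succ a (i + 1 + 1)
          simp only [Nat.succ_eq_add_one, add_assoc, Nat.reduceAdd] at this ⊢
          omega
        · have := Nat.choose_succ_succ a (i + 1)
          simp only [Nat.succ_eq_add_one, add_assoc, Nat.reduceAdd] at this ⊢
          rcases h4 with h4 | h4
          · left; omega
          · right; omega

theorem MRep.toMacaulay {i b f q : ℕ} (h : MRep i b f q) : 0 < f →
    ∃ j m, IsMacaulayRep f i j m ∧ macaulayUpper i j m = f + q ∧ m i < b := by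
  induction h with
  | nil => intro h; omega
  | cons i b a f q h hr ih =>
    intro hf
    have hP := Nat.choose_succ_succ a (i + 1)
    simp only [Nat.succ_eq_add_one, add_assoc, Nat.reduceAdd] at hP
    by_cases hf0 : f = 0
    · subst hf0
      have hq : q ≤ 0 := hr.mono (MRep.nil i 0) le_rfl
      have ha : i + 1 ≤ a := by
        by_contra hlt
        rw [Nat.choose_eq_zero_of_lt (by omega)] at hf
        omega
      refine ⟨0, fun _ => a, ⟨by omega, by simpa using ha, ?_, ?_⟩, ?_, h⟩
      · intro k h1 h2; omega
      · simp
      · simp only [macaulayUpper, Nat.sub_zero, Finset.Icc_self, Finset.sum_singleton, add_assoc,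
          Nat.reduceAdd]
        omega
    · obtain ⟨j, m, ⟨h1, h2, h3, h4⟩, h5, h6⟩ := ih (by omega)
      have hs : i + 1 - (j + 1) = i - j := by omega
      have hne : ∀ k ∈ Finset.Icc (i - j) i, Function.update m (i + 1) a k = m k := by
        intro k hk
        rw [Finset.mem_Icc] at hk
        exact Function.update_of_ne (by omega) _ _
      refine ⟨j + 1, Function.update m (i + 1) a, ⟨by omega, ?_, ?_, ?_⟩, ?_, ?_⟩
      · rw [hs, hne _ (Finset.mem_Icc.2 ⟨le_rfl, by omega⟩)]; exact h2
      · rw [hs]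
        intro k hk1 hk2
        rw [hne _ (Finset.mem_Icc.2 ⟨hk1, by omega⟩)]
        by_cases hk : k = i
        · subst hk; simpa using h6
        · rw [hne _ (Finset.mem_Icc.2 ⟨by omega, by omega⟩)]
          exact h3 k hk1 (by omega)
      · rw [hs, Finset.sum_Icc_succ_top (by omega), h4]
        rw [Function.update_self, add_comm]
        congr 1
        exact Finset.sum_congr rfl fun k hk => by rw [hne k hk]
      · rw [macaulayUpper, hs, Finset.sum_Icc_succ_top (by omega)]
        rw [Function.update_self]
        have : ∑ k ∈ Finset.Icc (i - j) i, Nat.choose (Function.update m (i + 1) a k + 1) (k + 1)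
            = f + q := by
          rw [← h5, macaulayUpper]
          exact Finset.sum_congr rfl fun k hk => by rw [hne k hk]
        rw [this]
        simp only [add_assoc, Nat.reduceAdd]
        omega
      · simpa using h

section Compress

open Finset

theorem oneDim (A D : Finset ℕ) (t x : ℕ) (hA : A ⊆ range (t + 2)) (hx : x ≤ t) (hxA : x < #A)
    (h1 : ∀ b ∈ A, 1 ≤ b → b - 1 ∈ D) (h2 : ∀ b ∈ A, b ≤ t → b ∈ D) : x < #D := by
  by_cases hfull : range (t + 2) ⊆ A
  · have : range (t + 1) ⊆ D := by
      intro b hb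
      rw [mem_range] at hb
      exact h2 b (hfull (mem_range.2 (by omega))) (by omega)
    have := card_le_card this
    rw [card_range] at this
    omega
  · rw [not_subset] at hfull
    obtain ⟨r, hr, hrA⟩ := hfull
    rw [mem_range] at hr
    have hne : ∀ b ∈ A, b ≠ r := fun b hb h => hrA (h ▸ hb)
    refine lt_of_lt_of_le hxA
      (card_le_card_of_injOn (fun b => if b < r then b else b - 1) ?_ ?_)
    · intro b hb
      have hb : b ∈ A := hb
      have := hne b hb
      have h3 := mem_range.1 (hA hb)
      show (if b < r then b else b - 1) ∈ D
      split_ifs with h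
      · exact h2 b hb (by omega)
      · exact h1 b hb (by omega)
    · intro b hb c hc hbc
      have := hne b hb
      have := hne c hc
      simp only at hbc
      split_ifs at hbc <;> omega

theorem sum_range_card_le (A : Finset ℕ) :
    ∑ b ∈ range #A, b ≤ ∑ b ∈ A, b ∧ (A ≠ range #A → ∑ b ∈ range #A, b < ∑ b ∈ A, b) := by
  set c := #A with hc
  have e1 : ∑ b ∈ A \ range c, b + ∑ b ∈ A ∩ range c, b = ∑ b ∈ A, b := by
    rw [add_comm]; exact sum_inter_add_sum_sdiff A (range c) _
  have e2 : ∑ b ∈ range c \ A, b + ∑ b ∈ A ∩ range c, b = ∑ b ∈ range c, b := by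
    rw [add_comm, inter_comm]; exact sum_inter_add_sum_sdiff (range c) A _
  have hcard : #(A \ range c) = #(range c \ A) := by
    have h1 := card_sdiff_add_card_inter A (range c)
    have h2 := card_sdiff_add_card_inter (range c) A
    rw [inter_comm, card_range] at h2
    omega
  have h1 : #(A \ range c) * c ≤ ∑ b ∈ A \ range c, b := by
    rw [← smul_eq_mul]
    refine card_nsmul_le_sum _ _ _ fun b hb => ?_
    rw [mem_sdiff, mem_range] at hb
    omega
  have h2 : ∑ b ∈ range c \ A, (b + 1) ≤ #(range c \ A) * c := by
    rw [← smul_eq_mul]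
    refine sum_le_card_nsmul _ _ _ fun b hb => ?_
    rw [mem_sdiff, mem_range] at hb
    omega
  rw [sum_add_distrib, ← card_eq_sum_ones, ← hcard] at h2
  refine ⟨by omega, fun hne => ?_⟩
  have : 0 < #(A \ range c) := by
    rw [card_pos]
    by_contra hem
    rw [not_nonempty_iff_eq_empty, sdiff_eq_empty_iff_subset] at hem
    exact hne (eq_of_subset_of_card_le hem (by simp [hc]))
  omega

variable {ι : Type*} [DecidableEq ι]

/-- Moving along the fibre in directions `z`, `j`. -/
def fpt (z j : ι) (u : ι → ℕ) (b : ℕ) : ι → ℕ :=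
  fun x => if x = z then u z + u j - b else if x = j then b else u x

open Classical in
/-- The fibre of `M` through `u`. -/
noncomputable def fib (z j : ι) (M : Finset (ι → ℕ)) (u : ι → ℕ) : Finset ℕ :=
  (range (u z + u j + 1)).filter fun b => fpt z j u b ∈ M

open Classical in
/-- Compression. -/
noncomputable def cpr (s : Finset ι) (k : ℕ) (z j : ι) (M : Finset (ι → ℕ)) : Finset (ι → ℕ) :=
  (piAntidiag s k).filter fun u => u j < #(fib z j M u)

open Classical in
/-- Shadow. -/
noncomputable def shd (s : Finset ι) (k : ℕ) (M : Finset (ι → ℕ)) : Finset (ι → ℕ) :=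
  (piAntidiag s k).filter fun v => ∃ l ∈ s, v + Pi.single l 1 ∈ M

theorem mem_fib {z j : ι} {M : Finset (ι → ℕ)} {u : ι → ℕ} {b : ℕ} :
    b ∈ fib z j M u ↔ b < u z + u j + 1 ∧ fpt z j u b ∈ M := by
  classical
  simp only [fib, mem_filter, mem_range]

theorem mem_cpr {s : Finset ι} {k : ℕ} {z j : ι} {M : Finset (ι → ℕ)} {u : ι → ℕ} :
    u ∈ cpr s k z j M ↔ u ∈ piAntidiag s k ∧ u j < #(fib z j M u) := by
  classical
  simp only [cpr, mem_filter]

theorem mem_shd {s : Finset ι} {k : ℕ} {M : Finset (ι → ℕ)} {v : ι → ℕ} :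
    v ∈ shd s k M ↔ v ∈ piAntidiag s k ∧ ∃ l ∈ s, v + Pi.single l 1 ∈ M := by
  classical
  simp only [shd, mem_filter]

theorem mem_pA {s : Finset ι} {k : ℕ} {v : ι → ℕ} :
    v ∈ piAntidiag s k ↔ ∑ i ∈ s, v i = k ∧ ∀ i, v i ≠ 0 → i ∈ s := mem_piAntidiag

theorem fpt_mem {s : Finset ι} {k : ℕ} {z j : ι} (hz : z ∈ s) (hj : j ∈ s) (hzj : j ≠ z)
    {u : ι → ℕ} (hu : u ∈ piAntidiag s k) {b : ℕ} (hb : b ≤ u z + u j) :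
    fpt z j u b ∈ piAntidiag s k := by
  rw [mem_pA] at hu ⊢
  obtain ⟨h1, h2⟩ := hu
  have hj' : j ∈ s.erase z := mem_erase.2 ⟨hzj, hj⟩
  refine ⟨?_, ?_⟩
  · rw [← add_sum_erase s _ hz, ← add_sum_erase _ _ hj'] at h1 ⊢
    have : ∑ x ∈ (s.erase z).erase j, fpt z j u b x = ∑ x ∈ (s.erase z).erase j, u x := by
      refine sum_congr rfl fun x hx => ?_
      simp only [mem_erase] at hx
      simp [fpt, hx.1, hx.2.1]
    rw [this]
    simp only [fpt, if_true, if_neg hzj]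
    omega
  · intro i hi
    by_cases hiz : i = z
    · subst hiz; exact hz
    · by_cases hij : i = j
      · subst hij; exact hj
      · refine h2 i ?_
        simpa [fpt, hiz, hij] using hi

theorem fpt_fpt {z j : ι} (hzj : j ≠ z) (u : ι → ℕ) (b c : ℕ) (hb : b ≤ u z + u j) :
    fpt z j (fpt z j u b) c = fpt z j u c := by
  funext x
  simp only [fpt, if_true, if_neg hzj]
  split_ifs <;> omega

theorem fpt_self {z j : ι} (u : ι → ℕ) : fpt z j u (u j) = u := by
  funext x
  simp only [fpt]
  split_ifs with h1 h2
  · subst h1; omega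
  · subst h2; rfl
  · rfl

theorem fib_fpt {z j : ι} (hzj : j ≠ z) (M : Finset (ι → ℕ)) (u : ι → ℕ) (b : ℕ)
    (hb : b ≤ u z + u j) : fib z j M (fpt z j u b) = fib z j M u := by
  have : fpt z j u b z + fpt z j u b j = u z + u j := by
    simp only [fpt, if_true, if_neg hzj]; omega
  ext c
  simp only [mem_fib, this, fpt_fpt hzj u b c hb]

theorem fib_cpr {s : Finset ι} {k : ℕ} {z j : ι} (hz : z ∈ s) (hj : j ∈ s) (hzj : j ≠ z)
    (M : Finset (ι → ℕ)) {u : ι → ℕ} (hu : u ∈ piAntidiag s k) :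
    fib z j (cpr s k z j M) u = range #(fib z j M u) := by
  have hle : #(fib z j M u) ≤ u z + u j + 1 := by
    have : fib z j M u ⊆ range (u z + u j + 1) := fun b hb => mem_range.2 (mem_fib.1 hb).1
    have := card_le_card this
    rwa [card_range] at this
  ext b
  rw [mem_fib, mem_range]
  constructor
  · rintro ⟨h1, h2⟩
    rw [mem_cpr, fib_fpt hzj M u b (by omega)] at h2
    simpa [fpt, hzj] using h2.2
  · intro h
    refine ⟨by omega, ?_⟩
    rw [mem_cpr, fib_fpt hzj M u b (by omega)]
    exact ⟨fpt_mem hz hj hzj hu (by omega), by simpa [fpt, hzj] using h⟩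

theorem sum_fib {s : Finset ι} {k : ℕ} {z j : ι} (hz : z ∈ s) (hj : j ∈ s) (hzj : j ≠ z)
    {M : Finset (ι → ℕ)} (hM : M ⊆ piAntidiag s k) (F : (ι → ℕ) → ℕ) :
    ∑ u ∈ M, F u = ∑ p ∈ (piAntidiag s k).filter (fun p => p j = 0),
      ∑ b ∈ fib z j M p, F (fpt z j p b) := by
  rw [sum_sigma']
  refine sum_bij' (fun u _ => (⟨fpt z j u 0, u j⟩ : (_ : ι → ℕ) × ℕ))
    (fun x _ => fpt z j x.1 x.2) ?_ ?_ ?_ ?_ ?_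
  · intro u hu
    rw [mem_sigma, mem_filter, mem_fib]
    refine ⟨⟨fpt_mem hz hj hzj (hM hu) (by omega), by simp [fpt, hzj]⟩, ?_, ?_⟩
    · simp [fpt, hzj]
    · simpa only [fpt_fpt hzj u 0 _ (Nat.zero_le _), fpt_self] using hu
  · rintro ⟨p, b⟩ hx
    rw [mem_sigma, mem_filter, mem_fib] at hx
    exact hx.2.2
  · intro u hu
    simp only [fpt_fpt hzj u 0 _ (Nat.zero_le _), fpt_self]
  · rintro ⟨p, b⟩ hx
    rw [mem_sigma, mem_filter, mem_fib] at hx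
    obtain ⟨⟨h1, h2⟩, h3, h4⟩ := hx
    simp only at h2 h3
    have e1 : fpt z j (fpt z j p b) 0 = p := by
      rw [fpt_fpt hzj p b _ (by omega), ← h2, fpt_self]
    have e2 : fpt z j p b j = b := by simp [fpt, hzj]
    simp only [e1, e2]
  · intro u hu
    simp only [fpt_fpt hzj u 0 _ (Nat.zero_le _), fpt_self]

theorem card_cpr {s : Finset ι} {k : ℕ} {z j : ι} (hz : z ∈ s) (hj : j ∈ s) (hzj : j ≠ z)
    {M : Finset (ι → ℕ)} (hM : M ⊆ piAntidiag s k) : #(cpr s k z j M) = #M := by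
  rw [card_eq_sum_ones, card_eq_sum_ones, sum_fib hz hj hzj hM,
    sum_fib hz hj hzj (M := cpr s k z j M) (filter_subset _ _)]
  refine sum_congr rfl fun p hp => ?_
  rw [fib_cpr hz hj hzj M (mem_filter.1 hp).1]
  simp

theorem pot_cpr {s : Finset ι} {k : ℕ} {z j : ι} (hz : z ∈ s) (hj : j ∈ s) (hzj : j ≠ z)
    {M : Finset (ι → ℕ)} (hM : M ⊆ piAntidiag s k)
    (hne : ∃ w : ι → ℕ, w + Pi.single j 1 ∈ M ∧ w + Pi.single z 1 ∉ M) :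
    ∑ u ∈ cpr s k z j M, (k - u z) < ∑ u ∈ M, (k - u z) := by
  rw [sum_fib hz hj hzj hM, sum_fib hz hj hzj (M := cpr s k z j M) (filter_subset _ _)]
  have key : ∀ p ∈ (piAntidiag s k).filter (fun p => p j = 0), ∀ N : Finset (ι → ℕ),
      ∑ b ∈ fib z j N p, (k - fpt z j p b z) = #(fib z j N p) * (k - p z) + ∑ b ∈ fib z j N p, b := by
    intro p hp N
    rw [mem_filter, mem_pA] at hp
    obtain ⟨⟨h1, h2⟩, h3⟩ := hp
    have hpz : p z ≤ k := h1 ▸ single_le_sum (fun _ _ => Nat.zero_le _) hz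
    rw [← smul_eq_mul, ← sum_const, ← sum_add_distrib]
    refine sum_congr rfl fun b hb => ?_
    rw [mem_fib] at hb
    simp only [fpt, if_true]
    omega
  have hb : ∀ p ∈ (piAntidiag s k).filter (fun p => p j = 0),
      fib z j (cpr s k z j M) p = range #(fib z j M p) := fun p hp =>
    fib_cpr hz hj hzj M (mem_filter.1 hp).1
  refine sum_lt_sum ?_ ?_
  · intro p hp
    rw [key p hp, key p hp, hb p hp, card_range]
    have := (sum_range_card_le (fib z j M p)).1
    omega
  · obtain ⟨w, hw1, hw2⟩ := hne
    set u := w + Pi.single j 1 with hu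
    have huz : u z = w z := by simp [hu, hzj.symm]
    have huj : u j = w j + 1 := by simp [hu]
    have hp : fpt z j u 0 ∈ (piAntidiag s k).filter (fun p => p j = 0) := by
      rw [mem_filter]
      exact ⟨fpt_mem hz hj hzj (hM hw1) (by omega), by simp [fpt, hzj]⟩
    refine ⟨fpt z j u 0, hp, ?_⟩
    rw [key _ hp, key _ hp, hb _ hp, card_range]
    have : fib z j M (fpt z j u 0) ≠ range #(fib z j M (fpt z j u 0)) := by
      rw [fib_fpt hzj M u 0 (by omega)]
      intro heq
      have m1 : w j + 1 ∈ fib z j M u := by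
        rw [mem_fib, ← huj, fpt_self]
        exact ⟨by omega, hw1⟩
      have m2 : w j ∉ fib z j M u := by
        rw [mem_fib]
        rintro ⟨-, h⟩
        apply hw2
        convert h using 1
        funext x
        simp only [fpt, huz, huj]
        by_cases hx : x = z
        · subst hx; simp; omega
        · by_cases hx' : x = j
          · subst hx'; simp [hx]
          · simp [hx, hx', hu]
      rw [heq, mem_range] at m1 m2
      omega
    have := (sum_range_card_le (fib z j M (fpt z j u 0))).2 this
    omega

theorem shd_cpr {s : Finset ι} {k : ℕ} {z j : ι} (hz : z ∈ s) (hj : j ∈ s) (hzj : j ≠ z)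
    (M : Finset (ι → ℕ)) : shd s k (cpr s (k + 1) z j M) ⊆ cpr s k z j (shd s k M) := by
  intro v hv
  rw [mem_shd] at hv
  obtain ⟨hv, l, hl, hc⟩ := hv
  rw [mem_cpr] at hc ⊢
  obtain ⟨hu, hc⟩ := hc
  refine ⟨hv, ?_⟩
  by_cases hlzj : l = z ∨ l = j
  · have ht : (v + Pi.single l 1 : ι → ℕ) z + (v + Pi.single l 1 : ι → ℕ) j = v z + v j + 1 := by
      rcases hlzj with rfl | rfl
      · simp [hzj]; omega
      · simp [hzj.symm]; omega
    have hjl : v j ≤ (v + Pi.single l 1 : ι → ℕ) j := by simp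
    refine oneDim (fib z j M (v + Pi.single l 1)) _ (v z + v j) (v j) ?_ (by omega) (by omega) ?_ ?_
    · intro b hb
      rw [mem_fib, ht] at hb
      exact mem_range.2 hb.1
    · intro b hb hb1
      rw [mem_fib, ht] at hb
      rw [mem_fib]
      refine ⟨by omega, ?_⟩
      rw [mem_shd]
      refine ⟨fpt_mem hz hj hzj hv (by omega), j, hj, ?_⟩
      convert hb.2 using 1
      funext x
      simp only [fpt, Pi.add_apply] at ht ⊢
      by_cases hx : x = z
      · subst hx; simp [hzj.symm] at ht ⊢; omega
      · by_cases hx' : x = j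
        · subst hx'; simp [hx]; omega
        · have : x ≠ l := by rintro rfl; tauto
          simp [hx, hx', this]
    · intro b hb hb1
      rw [mem_fib, ht] at hb
      rw [mem_fib]
      refine ⟨by omega, ?_⟩
      rw [mem_shd]
      refine ⟨fpt_mem hz hj hzj hv (by omega), z, hz, ?_⟩
      convert hb.2 using 1
      funext x
      simp only [fpt, Pi.add_apply] at ht ⊢
      by_cases hx : x = z
      · subst hx; simp at ht ⊢; omega
      · by_cases hx' : x = j
        · subst hx'; simp [hx]
        · have : x ≠ l := by rintro rfl; tauto
          simp [hx, hx', this]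
  · push Not at hlzj
    obtain ⟨h1, h2⟩ := hlzj
    have ez : (v + Pi.single l 1 : ι → ℕ) z = v z := by simp [h1.symm]
    have ej : (v + Pi.single l 1 : ι → ℕ) j = v j := by simp [h2.symm]
    rw [ej] at hc
    refine lt_of_lt_of_le hc (card_le_card ?_)
    intro b hb
    rw [mem_fib, ez, ej] at hb
    rw [mem_fib]
    refine ⟨hb.1, ?_⟩
    rw [mem_shd]
    refine ⟨fpt_mem hz hj hzj hv (by omega), l, hl, ?_⟩
    convert hb.2 using 1
    funext x
    simp only [fpt, Pi.add_apply]
    by_cases hx : x = z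
    · subst hx; simp [h1.symm, h2.symm]
    · by_cases hx' : x = j
      · subst hx'; simp [hx, h2.symm]
      · simp [hx, hx']

theorem exists_stable {s : Finset ι} {k : ℕ} {z : ι} (hz : z ∈ s) (n : ℕ) :
    ∀ M ⊆ piAntidiag s (k + 1), ∑ u ∈ M, (k + 1 - u z) = n →
    ∃ M' ⊆ piAntidiag s (k + 1), #M' = #M ∧ #(shd s k M') ≤ #(shd s k M) ∧
      ∀ w : ι → ℕ, ∀ l ∈ s, w + Pi.single l 1 ∈ M' → w + Pi.single z 1 ∈ M' := by
  induction n using Nat.strong_induction_on with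
  | _ n ih =>
    intro M hM hn
    by_cases hst : ∀ w : ι → ℕ, ∀ l ∈ s, w + Pi.single l 1 ∈ M → w + Pi.single z 1 ∈ M
    · exact ⟨M, hM, rfl, le_rfl, hst⟩
    · push Not at hst
      obtain ⟨w, j, hj, h1, h2⟩ := hst
      have hzj : j ≠ z := by rintro rfl; exact h2 h1
      obtain ⟨M', a1, a2, a3, a4⟩ := ih _ (hn ▸ pot_cpr hz hj hzj hM ⟨w, h1, h2⟩)
        (cpr s (k + 1) z j M) (filter_subset _ _) rfl
      refine ⟨M', a1, a2.trans (card_cpr hz hj hzj hM), a3.trans ?_, a4⟩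
      exact (card_le_card (shd_cpr hz hj hzj M)).trans
        (card_cpr hz hj hzj (fun _ h => (mem_shd.1 h).1)).le

/-- For a stable family the shadow consists of the quotients by the distinguished variable. -/
theorem mem_shd_stable {s : Finset ι} {k : ℕ} {z : ι} (hz : z ∈ s) {M : Finset (ι → ℕ)}
    (hM : M ⊆ piAntidiag s (k + 1))
    (hst : ∀ w : ι → ℕ, ∀ l ∈ s, w + Pi.single l 1 ∈ M → w + Pi.single z 1 ∈ M) (v : ι → ℕ) :
    v ∈ shd s k M ↔ v + Pi.single z 1 ∈ M := by
  rw [mem_shd]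
  constructor
  · rintro ⟨-, l, hl, h⟩
    exact hst v l hl h
  · intro h
    refine ⟨?_, z, hz, h⟩
    have := hM h
    rw [mem_pA] at this ⊢
    obtain ⟨h1, h2⟩ := this
    refine ⟨?_, fun i hi => h2 i (by simp [hi])⟩
    simp only [Pi.add_apply, sum_add_distrib, sum_pi_single', if_pos hz] at h1
    omega

theorem card_stable {s : Finset ι} {k : ℕ} {z : ι} (hz : z ∈ s) {M : Finset (ι → ℕ)}
    (hM : M ⊆ piAntidiag s (k + 1))
    (hst : ∀ w : ι → ℕ, ∀ l ∈ s, w + Pi.single l 1 ∈ M → w + Pi.single z 1 ∈ M) :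
    #M = #(shd s k M) + #(M.filter fun u => u z = 0) := by
  rw [← card_filter_add_card_filter_not (s := M) (fun u => u z = 0), add_comm]
  congr 1
  symm
  refine card_bij (fun v _ => v + Pi.single z 1) ?_ ?_ ?_
  · intro v hv
    rw [mem_shd_stable hz hM hst] at hv
    rw [mem_filter]
    exact ⟨hv, by simp⟩
  · intro a _ b _ h
    exact add_right_cancel h
  · intro u hu
    rw [mem_filter] at hu
    have : u - Pi.single z 1 + Pi.single z 1 = u := by
      funext x
      by_cases hx : x = z
      · subst hx; simp; omega
      · simp [hx]
    refine ⟨u - Pi.single z 1, ?_, this⟩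
    rw [mem_shd_stable hz hM hst, this]
    exact hu.1

theorem macaulay_main (s : Finset ι) : ∀ i, ∀ M ⊆ piAntidiag s (i + 1), ∀ b q,
    MRep i b #(shd s i M) q → #M ≤ #(shd s i M) + q := by
  induction s using Finset.induction_on with
  | empty =>
    intro i M hM b q _
    have : M = ∅ := by
      rw [piAntidiag_empty_of_ne_zero (by omega)] at hM
      exact subset_empty.1 hM
    simp [this]
  | insert z s' hzs ihs =>
    intro i
    have hz : z ∈ insert z s' := mem_insert_self _ _
    induction i with
    | zero =>
      intro M hM b q hR
      have h0 : #(shd (insert z s') 0 M) = 0 ∧ q = 0 := by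
        generalize #(shd (insert z s') 0 M) = f at hR
        cases hR
        exact ⟨rfl, rfl⟩
      have hst : M = ∅ := by
        obtain ⟨M', a1, a2, a3, a4⟩ := exists_stable hz _ M hM rfl
        rw [h0.1] at a3
        have hM' : M' = ∅ := by
          rw [eq_empty_iff_forall_notMem]
          intro u hu
          have hsum := (mem_pA.1 (a1 hu)).1
          obtain ⟨l, hl, hl0⟩ : ∃ l ∈ insert z s', u l ≠ 0 := by
            by_contra hcon
            push Not at hcon
            rw [sum_eq_zero hcon] at hsum
            omega
          have e : u - Pi.single l 1 + Pi.single l 1 = u := by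
            funext x
            by_cases hx : x = l
            · subst hx; simp; omega
            · simp [hx]
          have := a4 (u - Pi.single l 1) l hl (by rwa [e])
          rw [← mem_shd_stable hz a1 a4] at this
          have := card_pos.2 ⟨_, this⟩
          omega
        rw [hM', card_empty] at a2
        exact card_eq_zero.1 a2.symm
      simp [hst]
    | succ i ihi =>
      intro M hM b q hR
      obtain ⟨M', a1, a2, a3, a4⟩ := exists_stable hz _ M hM rfl
      obtain ⟨b', q', hR'⟩ := MRep.exists_succ i #(shd (insert z s') (i + 1) M')
      have hqq := hR'.mono hR a3
      rw [← a2]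
      suffices h : #M' ≤ #(shd (insert z s') (i + 1) M') + q' by omega
      clear hqq a3 a2 hR hM
      set N := shd (insert z s') (i + 1) M' with hN
      have hNsub : N ⊆ piAntidiag (insert z s') (i + 1) := fun _ h => (mem_shd.1 h).1
      have hNst : ∀ w : ι → ℕ, ∀ l ∈ insert z s', w + Pi.single l 1 ∈ N →
          w + Pi.single z 1 ∈ N := by
        intro w l hl hw
        rw [hN, mem_shd_stable hz a1 a4] at hw ⊢
        apply a4 _ l hl
        rwa [add_right_comm]
      have cM := card_stable hz a1 a4
      rw [← hN] at cM
      have cN := card_stable hz hNsub hNst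
      have sub0 : ∀ (k : ℕ) (L : Finset (ι → ℕ)), L ⊆ piAntidiag (insert z s') k →
          L.filter (fun u => u z = 0) ⊆ piAntidiag s' k := by
        intro k L hL u hu
        rw [mem_filter] at hu
        have h1 := hL hu.1
        rw [mem_pA, sum_insert hzs, hu.2, zero_add] at h1
        rw [mem_pA]
        refine ⟨h1.1, fun x hx => ?_⟩
        rcases mem_insert.1 (h1.2 x hx) with h | h
        · subst h; exact absurd hu.2 hx
        · exact h
      set M0 := M'.filter (fun u => u z = 0) with hM0
      set N0 := N.filter (fun u => u z = 0) with hN0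
      have hsh : shd s' (i + 1) M0 ⊆ N0 := by
        intro v hv
        rw [mem_shd] at hv
        obtain ⟨hv, l, hl, h⟩ := hv
        rw [hM0, mem_filter] at h
        rw [hN0, mem_filter, hN, mem_shd_stable hz a1 a4]
        refine ⟨a4 v l (mem_insert_of_mem hl) h.1, ?_⟩
        have := h.2
        simp only [Pi.add_apply] at this
        omega
      obtain ⟨b0, q0, hR0⟩ := MRep.exists_succ i #(shd s' (i + 1) M0)
      have hm0 := ihs (i + 1) M0 (sub0 _ _ a1) b0 q0 hR0
      obtain ⟨fm, qm, e, p, g1, g2, g3, g4⟩ := MRep.green _ _ _ _ hR'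
      have hn0 : #N0 ≤ fm := by
        by_contra hcon
        have hle : #(shd (insert z s') i N) ≤ e := by omega
        obtain ⟨b2, q2, hR2⟩ := g3.exists_le hle
        have := ihi N hNsub b2 q2 hR2
        have := hR2.mono g3 hle
        omega
      have hle := card_le_card hsh
      have := hR0.mono g1 (by omega)
      omega

end Compress

/-- For a nonempty subset `T` of the level set `{a ∈ ℤ_{>0}^d : Σ a_i = m}`,
the level counts `h_l(T) = |{x ∈ I(T) : Σ x_i = l}|`, `d ≤ l ≤ m`, form an
O-sequence whose first entry is `1` and whose second entry is at most `d`. -/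
theorem stmt10 (d m : ℕ) (hd : 0 < d) (hm : d ≤ m) (T : Set (Fin d → ℕ))
    (hne : T.Nonempty) (hT : ∀ a ∈ T, (∀ i, 0 < a i) ∧ ∑ i, a i = m) :
    IsOSequence (m - d)
      (fun l => ({x ∈ posDown d T | ∑ j, x j = d + l}).ncard) ∧
    ({x ∈ posDown d T | ∑ j, x j = d}).ncard = 1 ∧
    ({x ∈ posDown d T | ∑ j, x j = d + 1}).ncard ≤ d := by
  classical
  set M : ℕ → Finset (Fin d → ℕ) := fun l =>
    (Finset.piAntidiag Finset.univ l).filter (fun y => y + 1 ∈ posDown d T) with hMdef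
  have hcard : ∀ l, ({x ∈ posDown d T | ∑ j, x j = d + l}).ncard = (M l).card := by
    intro l
    rw [← Set.ncard_coe_finset, ← Set.ncard_image_of_injective (M l : Set (Fin d → ℕ))
      (add_left_injective (1 : Fin d → ℕ))]
    congr 1
    ext x
    simp only [hMdef, Set.mem_ofPred_eq, Set.mem_image, Finset.mem_coe, Finset.mem_filter,
      mem_pA]
    constructor
    · rintro ⟨h1, h2⟩
      have e : x - 1 + 1 = x := by
        funext t
        have := h1.1 t
        simp only [Pi.add_apply, Pi.sub_apply, Pi.one_apply]
        omega
      refine ⟨x - 1, ⟨⟨?_, fun _ _ => Finset.mem_univ _⟩, by rwa [e]⟩, e⟩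
      rw [← e] at h2
      simp only [Pi.add_apply, Pi.one_apply, Finset.sum_add_distrib, Finset.sum_const,
        Finset.card_univ, Fintype.card_fin, smul_eq_mul, mul_one] at h2
      omega
    · rintro ⟨y, ⟨⟨h1, -⟩, h2⟩, rfl⟩
      refine ⟨h2, ?_⟩
      simp only [Pi.add_apply, Pi.one_apply, Finset.sum_add_distrib, Finset.sum_const,
        Finset.card_univ, Fintype.card_fin, smul_eq_mul, mul_one]
      omega
  have h0 : (M 0).card = 1 := by
    rw [Finset.card_eq_one]
    refine ⟨0, ?_⟩
    ext y
    simp only [hMdef, Finset.mem_filter, Finset.piAntidiag_zero, Finset.mem_singleton]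
    constructor
    · exact fun h => h.1
    · rintro rfl
      obtain ⟨a, ha⟩ := hne
      refine ⟨rfl, fun t => by simp, a, ha, fun t => ?_⟩
      have := (hT a ha).1 t
      simp only [Pi.add_apply, Pi.zero_apply, Pi.one_apply]
      omega
  refine ⟨⟨?_, ?_⟩, ?_, ?_⟩
  · exact (hcard 0).trans h0
  · intro i hi _
    simp only [hcard]
    have hsub : shd Finset.univ i (M (i + 1)) ⊆ M i := by
      intro v hv
      rw [mem_shd] at hv
      obtain ⟨hv, l, -, h⟩ := hv
      simp only [hMdef, Finset.mem_filter] at h ⊢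
      obtain ⟨-, -, a, ha, hle⟩ := h
      refine ⟨hv, fun t => by simp, a, ha, fun t => le_trans ?_ (hle t)⟩
      simp only [Pi.add_apply]
      omega
    obtain ⟨i, rfl⟩ : ∃ i', i = i' + 1 := ⟨i - 1, by omega⟩
    obtain ⟨b, q, hR⟩ := MRep.exists_succ i (M (i + 1)).card
    obtain ⟨b', q', hR'⟩ := MRep.exists_succ i (shd Finset.univ (i + 1) (M (i + 1 + 1))).card
    have h1 := macaulay_main Finset.univ (i + 1) (M (i + 1 + 1)) (Finset.filter_subset _ _) b' q' hR'
    have h2 := Finset.card_le_card hsub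
    have h3 := hR'.mono hR h2
    by_cases hf : (M (i + 1)).card = 0
    · left
      refine ⟨hf, ?_⟩
      rw [hf] at h2
      have h4 := hR'.mono (MRep.nil (i + 1) 0) h2
      omega
    · right
      obtain ⟨j, mm, e1, e2, -⟩ := hR.toMacaulay (Nat.pos_of_ne_zero hf)
      exact ⟨j, mm, e1, by omega⟩
  · exact (hcard 0).trans h0
  · rw [hcard 1]
    have : M 1 ⊆ Finset.univ.image (fun t : Fin d => (Pi.single t 1 : Fin d → ℕ)) := by
      intro y hy
      simp only [hMdef, Finset.mem_filter, mem_pA] at hy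
      have hs := hy.1.1
      obtain ⟨t, ht⟩ : ∃ t, y t ≠ 0 := by
        by_contra hcon
        push Not at hcon
        simp [hcon] at hs
      rw [Finset.mem_image]
      refine ⟨t, Finset.mem_univ _, ?_⟩
      rw [← Finset.add_sum_erase _ _ (Finset.mem_univ t)] at hs
      have hz : ∑ x ∈ Finset.univ.erase t, y x = 0 := by omega
      rw [Finset.sum_eq_zero_iff] at hz
      funext x
      by_cases hx : x = t
      · subst hx; simp; omega
      · simp [hx, hz x (by simp [hx])]
    refine (Finset.card_le_card this).trans (Finset.card_image_le.trans ?_)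
    simp
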